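/- Let v and w be distinct vertices and suppose that in every elementary route R that is feasible for some t ∈ [0, T], v appears strictly before w. Let D' be the transport network obtained from D by replacing the time window lower bound of w by a'(w) = max{a(w), EAT(v, w)} and the time window upper bound of v by b'(v) = min{b(v), LDT(v, w)}, where EAT and LDT are computed in D, leaving all other data unchanged. Then for every elementary route R and every t ∈ [0, T]: R is feasible for t in D if and only if R is feasible for t in D', and in that case δ_D(R, t, i) = δ_{D'}(R, t, i) for every position i. -/

import Mathlib

noncomputable section

attribute [local instance] Classical.propDecidable

/-- `delta τ a r t i`: earliest arrival time at the `i`-th vertex of the partial route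
`⟨r 0, …, r k⟩` when the vehicle departs from `r 0` at time `t`, taking waiting
times (lower time-window bounds `a`) into account. -/
def delta (τ : ℕ → ℕ → ℝ) (a : ℕ → ℝ) (r : ℕ → ℕ) (t : ℝ) : ℕ → ℝ
  | 0 => max t (a (r 0))
  | i + 1 => max (delta τ a r t i + τ (r i) (r (i + 1))) (a (r (i + 1)))

/-- The partial route `⟨r 0, …, r k⟩` is feasible for departure time `t`:
the departure is not before `a (r 0)` and every vertex is reached before the
end `b` of its time window. -/
def Feasible (τ : ℕ → ℕ → ℝ) (a b : ℕ → ℝ) (r : ℕ → ℕ) (k : ℕ) (t : ℝ) : Prop :=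
  a (r 0) ≤ t ∧ ∀ i ≤ k, delta τ a r t i ≤ b (r i)

/-- An elementary route in the network with customers `1, …, n`: it starts at the
start depot `0`, ends at the end depot `n+1`, stays within the vertex set
`{0, …, n+1}`, and visits each vertex exactly once. -/
def ElemRoute (n : ℕ) (r : ℕ → ℕ) : Prop :=
  r 0 = 0 ∧ r (n + 1) = n + 1 ∧ (∀ i ≤ n + 1, r i ≤ n + 1) ∧
    ∀ i ≤ n + 1, ∀ j ≤ n + 1, r i = r j → i = j

/-- `EAT w v`: earliest arrival time at `v` after visiting `w`, i.e. the infimum of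
the arrival times `delta τ a u (a w) k` over all partial routes `u` starting at `w`,
ending at `v`, and feasible for departure time `a w` (`⊤ = ∞` if no such route exists). -/
def EAT (τ : ℕ → ℕ → ℝ) (a b : ℕ → ℝ) (w v : ℕ) : EReal :=
  sInf {x : EReal | ∃ (u : ℕ → ℕ) (k : ℕ), u 0 = w ∧ u k = v ∧
    Feasible τ a b u k (a w) ∧ x = ((delta τ a u (a w) k : ℝ) : EReal)}

/-- `LDT T w v`: latest departure time from `w` before visiting `v`, i.e. the supremum
of all times `t ∈ [0, T]` for which some partial route starting at `w` and ending at `v`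
is feasible (`⊥ = -∞` if no such time exists). -/
def LDT (τ : ℕ → ℕ → ℝ) (a b : ℕ → ℝ) (T : ℝ) (w v : ℕ) : EReal :=
  sSup {x : EReal | ∃ t : ℝ, x = (t : EReal) ∧ t ∈ Set.Icc 0 T ∧
    ∃ (u : ℕ → ℕ) (k : ℕ), u 0 = w ∧ u k = v ∧ Feasible τ a b u k t}

theorem le_delta (τ : ℕ → ℕ → ℝ) (a : ℕ → ℝ) (r : ℕ → ℕ) (t : ℝ) (i : ℕ) :
    a (r i) ≤ delta τ a r t i := by
  cases i <;> exact le_max_right _ _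

theorem delta_mono (τ : ℕ → ℕ → ℝ) {a a' : ℕ → ℝ} (r : ℕ → ℕ) {t t' : ℝ}
    (ha : a ≤ a') (ht : t ≤ t') (i : ℕ) : delta τ a r t i ≤ delta τ a' r t' i := by
  induction i with
  | zero => exact max_le_max ht (ha _)
  | succ i ih => exact max_le_max (by gcongr) (ha _)

/-- Restarting a route at its `i`-th vertex at the arrival time there. -/
theorem delta_shift (τ : ℕ → ℕ → ℝ) (a : ℕ → ℝ) (r : ℕ → ℕ) (t : ℝ) (i m : ℕ) :
    delta τ a (fun l => r (i + l)) (delta τ a r t i) m = delta τ a r t (i + m) := by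
  induction m with
  | zero => exact max_eq_left (le_delta τ a r t i)
  | succ m ih => rw [delta, ih, ← add_assoc, delta]

/-- Raising lower bounds to values not above the arrival times changes no arrival time. -/
theorem delta_eq_of_le (τ : ℕ → ℕ → ℝ) {a a' : ℕ → ℝ} {r : ℕ → ℕ} {t : ℝ} {k : ℕ}
    (ha : a ≤ a') (h₀ : a' (r 0) ≤ t) (h : ∀ i ≤ k, a' (r i) ≤ delta τ a r t i) :
    ∀ i ≤ k, delta τ a r t i = delta τ a' r t i := by
  intro i hi
  induction i with
  | zero => simp only [delta, max_eq_left h₀, max_eq_left ((ha _).trans h₀)]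
  | succ i ih =>
    refine le_antisymm (delta_mono τ r ha le_rfl _) ?_
    rw [delta, ← ih (by omega)]
    exact max_le (le_max_left _ _) (h _ hi)

theorem Feasible.shift {τ : ℕ → ℕ → ℝ} {a b : ℕ → ℝ} {r : ℕ → ℕ} {k : ℕ} {t : ℝ}
    (h : Feasible τ a b r k t) {i m : ℕ} (him : i + m ≤ k) :
    Feasible τ a b (fun l => r (i + l)) m (delta τ a r t i) := by
  refine ⟨le_delta τ a r t i, fun l hl => ?_⟩
  rw [delta_shift]
  exact h.2 _ (by omega)

theorem Feasible.anti_time {τ : ℕ → ℕ → ℝ} {a b : ℕ → ℝ} {r : ℕ → ℕ} {k : ℕ} {t t' : ℝ}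
    (h : Feasible τ a b r k t') (ht : t ≤ t') (h₀ : a (r 0) ≤ t) : Feasible τ a b r k t :=
  ⟨h₀, fun i hi => (delta_mono τ r le_rfl ht i).trans (h.2 i hi)⟩

/-- Enlarging time windows preserves feasibility. -/
theorem Feasible.mono_window {τ : ℕ → ℕ → ℝ} {a a' b b' : ℕ → ℝ} {r : ℕ → ℕ} {k : ℕ} {t : ℝ}
    (h : Feasible τ a' b' r k t) (ha : a ≤ a') (hb : b' ≤ b) : Feasible τ a b r k t :=
  ⟨(ha _).trans h.1, fun i hi =>
    ((delta_mono τ r ha le_rfl i).trans (h.2 i hi)).trans (hb _)⟩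

theorem Feasible.EAT_le_delta {τ : ℕ → ℕ → ℝ} {a b : ℕ → ℝ} {r : ℕ → ℕ} {k : ℕ} {t : ℝ}
    (h : Feasible τ a b r k t) {i j : ℕ} (hij : i ≤ j) (hj : j ≤ k) :
    EAT τ a b (r i) (r j) ≤ (delta τ a r t j : ℝ) := by
  obtain ⟨m, rfl⟩ := Nat.exists_eq_add_of_le hij
  have hs := (h.shift hj).anti_time (le_delta τ a r t i) le_rfl
  have hle : EAT τ a b (r i) (r (i + m)) ≤ (delta τ a (fun l => r (i + l)) (a (r i)) m : ℝ) :=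
    sInf_le ⟨fun l => r (i + l), m, rfl, rfl, hs, rfl⟩
  refine hle.trans ?_
  rw [EReal.coe_le_coe_iff, ← delta_shift]
  exact delta_mono τ _ le_rfl (le_delta τ a r t i) m

theorem Feasible.delta_le_LDT {τ : ℕ → ℕ → ℝ} {a b : ℕ → ℝ} {T : ℝ} {r : ℕ → ℕ} {k : ℕ}
    {t : ℝ} (h : Feasible τ a b r k t) (hwin : ∀ x, 0 ≤ a x ∧ b x ≤ T)
    {i j : ℕ} (hij : i ≤ j) (hj : j ≤ k) :
    ((delta τ a r t i : ℝ) : EReal) ≤ LDT τ a b T (r i) (r j) := by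
  obtain ⟨m, rfl⟩ := Nat.exists_eq_add_of_le hij
  exact le_sSup ⟨_, rfl, ⟨(hwin _).1.trans (le_delta τ a r t i),
    (h.2 i (by omega)).trans (hwin _).2⟩, fun l => r (i + l), m, rfl, rfl, h.shift hj⟩

/-- Time-window tightening: if `v` appears strictly before `w` in every elementary
route feasible for some `t ∈ [0, T]`, then replacing `a w` by `max (a w) (EAT v w)`
and `b v` by `min (b v) (LDT v w)` changes neither the feasibility of any elementary
route for any `t ∈ [0, T]` nor, for feasible routes, any of the arrival times. -/
theorem stmt13 (n : ℕ) (τ : ℕ → ℕ → ℝ) (a b : ℕ → ℝ) (T : ℝ)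
    (hab : ∀ x, a x ≤ b x) (hT : 0 ≤ T) (hwin : ∀ x, 0 ≤ a x ∧ b x ≤ T)
    (hdep0 : a 0 = 0 ∧ b 0 = T) (hdepn : a (n + 1) = 0 ∧ b (n + 1) = T)
    (v w : ℕ) (hvw : v ≠ w)
    (eatvw ldtvw : ℝ)
    (hEAT : EAT τ a b v w = ((eatvw : ℝ) : EReal))
    (hLDT : LDT τ a b T v w = ((ldtvw : ℝ) : EReal))
    (hprec : ∀ (r : ℕ → ℕ) (t : ℝ), ElemRoute n r → t ∈ Set.Icc (0 : ℝ) T →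
      Feasible τ a b r (n + 1) t → ∃ i j, i < j ∧ j ≤ n + 1 ∧ r i = v ∧ r j = w)
    (a' b' : ℕ → ℝ)
    (ha' : a' = Function.update a w (max (a w) eatvw))
    (hb' : b' = Function.update b v (min (b v) ldtvw)) :
    ∀ (r : ℕ → ℕ) (t : ℝ), ElemRoute n r → t ∈ Set.Icc (0 : ℝ) T →
      (Feasible τ a b r (n + 1) t ↔ Feasible τ a' b' r (n + 1) t) ∧
        (Feasible τ a b r (n + 1) t →
          ∀ i ≤ n + 1, delta τ a r t i = delta τ a' r t i) := by
  intro r t hr ht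
  have ha : a ≤ a' := by
    rw [ha', le_update_iff]
    exact ⟨le_max_left _ _, fun _ _ => le_rfl⟩
  have hb : b' ≤ b := by
    rw [hb', update_le_iff]
    exact ⟨min_le_left _ _, fun _ _ => le_rfl⟩
  have key : Feasible τ a b r (n + 1) t →
      Feasible τ a' b' r (n + 1) t ∧ ∀ i ≤ n + 1, delta τ a r t i = delta τ a' r t i := by
    intro hf
    obtain ⟨i, j, hij, hj, hi_v, hj_w⟩ := hprec r t hr ht hf
    have hE := hf.EAT_le_delta hij.le hj
    have hL := hf.delta_le_LDT hwin hij.le hj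
    rw [hi_v, hj_w, hEAT, EReal.coe_le_coe_iff] at hE
    rw [hi_v, hj_w, hLDT, EReal.coe_le_coe_iff] at hL
    have hlow : ∀ l ≤ n + 1, a' (r l) ≤ delta τ a r t l := by
      intro l hl
      by_cases h : r l = w
      · obtain rfl : l = j := hr.2.2.2 l hl j hj (h.trans hj_w.symm)
        rw [ha', h, Function.update_self]
        exact max_le (h ▸ le_delta τ a r t l) hE
      · rw [ha', Function.update_of_ne h]
        exact le_delta τ a r t l
    have hup : ∀ l ≤ n + 1, delta τ a r t l ≤ b' (r l) := by
      intro l hl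
      by_cases h : r l = v
      · obtain rfl : l = i := hr.2.2.2 l hl i (by omega) (h.trans hi_v.symm)
        rw [hb', h, Function.update_self]
        exact le_min (h ▸ hf.2 l hl) hL
      · rw [hb', Function.update_of_ne h]
        exact hf.2 l hl
    have h₀ : a' (r 0) ≤ t := by
      have h : r 0 ≠ w := fun h => by
        have := hr.2.2.2 0 (by omega) j hj (h.trans hj_w.symm)
        omega
      rw [ha', Function.update_of_ne h]
      exact hf.1
    have heq := delta_eq_of_le τ ha h₀ hlow
    exact ⟨⟨h₀, fun l hl => heq l hl ▸ hup l hl⟩, heq⟩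
  exact ⟨⟨fun h => (key h).1, fun h => h.mono_window ha hb⟩, fun h => (key h).2⟩
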